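/- arXiv:1508.01500 — 3 statements merged into one kernel-verified Lean document; each statement's English description precedes it below -/
import Mathlib

section
/- Let u ∈ H^{1/2}₊(S¹) and let x ∈ ℝ satisfy x·‖H_u‖_op² < 1, and set J_x(u) := ((I − xH_u²)^{-1} 1 | 1) (which is positive). Then: (i) (I − xK_u²)^{-1} u = (1/J_x(u)) (I − xH_u²)^{-1} u; and (ii) for every f ∈ L²₊, (I − xH_u²)^{-1} f − (I − xK_u²)^{-1} f = (x/J_x(u)) · (f | (I − xH_u²)^{-1} u) · (I − xH_u²)^{-1} u. -/
open Complex Filter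
open scoped ComplexConjugate Topology ENNReal

noncomputable section

/-- ℓ²(ℕ, ℂ): the sequence model of the Hardy space L²₊(S¹), identifying a function
with its sequence of nonnegative Fourier coefficients. -/
abbrev Hardy : Type := lp (fun _ : ℕ => ℂ) 2

/-- A coefficient sequence belongs to L²₊. -/
def MemL2 (u : ℕ → ℂ) : Prop := Memℓp u 2

/-- A coefficient sequence belongs to the Sobolev space H^s₊. -/
def MemHs (s : ℝ) (u : ℕ → ℂ) : Prop :=
  Summable fun n : ℕ => ((1 : ℝ) + (n : ℝ) ^ 2) ^ s * ‖u n‖ ^ 2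

/-- The squared H^s norm of a coefficient sequence. -/
def hsNormSq (s : ℝ) (u : ℕ → ℂ) : ℝ :=
  ∑' n : ℕ, ((1 : ℝ) + (n : ℝ) ^ 2) ^ s * ‖u n‖ ^ 2

/-- The L² inner product (f|g), ℂ-linear in the first argument. -/
def hinner (f g : ℕ → ℂ) : ℂ := ∑' n : ℕ, f n * conj (g n)

/-- The squared L² norm. -/
def l2normSq (f : ℕ → ℂ) : ℝ := ∑' n : ℕ, ‖f n‖ ^ 2

/-- Coefficients of the constant function 1. -/
def oneSeq : ℕ → ℂ := fun n => if n = 0 then 1 else 0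

/-- The Hankel operator H_u(h) = Π(u ⬝ conj h) in Fourier coefficients. -/
def hankel (u h : ℕ → ℂ) : ℕ → ℂ := fun k => ∑' ℓ : ℕ, u (k + ℓ) * conj (h ℓ)

/-- The shifted Hankel operator K_u = T_z^* ∘ H_u in Fourier coefficients. -/
def khankel (u h : ℕ → ℂ) : ℕ → ℂ := fun k => ∑' ℓ : ℕ, u (k + 1 + ℓ) * conj (h ℓ)

/-- H_u². -/
def hu2 (u h : ℕ → ℂ) : ℕ → ℂ := hankel u (hankel u h)

/-- K_u². -/
def ku2 (u h : ℕ → ℂ) : ℕ → ℂ := khankel u (khankel u h)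

/-- The m-th Fourier coefficient of |u|², m ∈ ℤ. -/
def absSqCoeff (u : ℕ → ℂ) (m : ℤ) : ℂ :=
  ∑' q : ℕ × ℕ, if ((q.1 : ℤ) - (q.2 : ℤ) = m) then u q.1 * conj (u q.2) else 0

/-- The Toeplitz operator T_{|u|²} in Fourier coefficients. -/
def toeplitzAbsSq (u h : ℕ → ℂ) : ℕ → ℂ :=
  fun k => ∑' ℓ : ℕ, absSqCoeff u ((k : ℤ) - (ℓ : ℤ)) * h ℓ

/-- Fourier coefficients of Π(|u|²u). -/
def cubic (u : ℕ → ℂ) : ℕ → ℂ := fun n =>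
  ∑' q : ℕ × ℕ × ℕ, if q.1 + q.2.2 = q.2.1 + n then u q.1 * conj (u q.2.1) * u q.2.2 else 0

/-- `u : ℝ → (ℕ → ℂ)` solves the α-Szegő equation i ∂ₜ u = Π(|u|²u) + α(u|1),
written coefficientwise on nonnegative Fourier modes. -/
def SolvesSzego (α : ℝ) (u : ℝ → ℕ → ℂ) : Prop :=
  ∀ n t, HasDerivAt (fun τ => u τ n)
    (-Complex.I * (cubic (u t) n + (α : ℂ) * u t 0 * oneSeq n)) t

/-- `u` is a smooth curve valued in H^s₊. -/
def SmoothHsCurve (s : ℝ) (u : ℝ → ℕ → ℂ) : Prop :=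
  (∀ t, MemHs s (u t)) ∧ ∀ n, ContDiff ℝ (⊤ : ℕ∞) fun t => u t n

/-- `u` is a continuous curve valued in H^s₊. -/
def ContHsCurve (s : ℝ) (u : ℝ → ℕ → ℂ) : Prop :=
  (∀ t, MemHs s (u t)) ∧
    ∀ t₀ : ℝ, Tendsto (fun t => hsNormSq s (fun n => u t n - u t₀ n)) (𝓝 t₀) (𝓝 0)

/-- E_u(τ) = ker(H_u² − τ² I) as a subset of ℓ². -/
def Espace (u : ℕ → ℂ) (τ : ℝ) : Set (ℕ → ℂ) :=
  {h | MemL2 h ∧ hu2 u h = ((τ : ℂ) ^ 2) • h}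

/-- F_u(τ) = ker(K_u² − τ² I) as a subset of ℓ². -/
def Fspace (u : ℕ → ℂ) (τ : ℝ) : Set (ℕ → ℂ) :=
  {h | MemL2 h ∧ ku2 u h = ((τ : ℂ) ^ 2) • h}

/-- Σ_H(u): τ > 0 such that E_u(τ) is not orthogonal to u. -/
def SigmaH (u : ℕ → ℂ) : Set ℝ :=
  {τ : ℝ | 0 < τ ∧ ∃ v ∈ Espace u τ, hinner u v ≠ 0}

/-- Σ_K(u): τ ≥ 0 such that F_u(τ) is not orthogonal to u. -/
def SigmaK (u : ℕ → ℂ) : Set ℝ :=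
  {τ : ℝ | 0 ≤ τ ∧ ∃ v ∈ Fspace u τ, hinner u v ≠ 0}

/-- `p` is the orthogonal projection of `w` on the subspace `V` of ℓ². -/
def IsOrthProj (V : Set (ℕ → ℂ)) (w p : ℕ → ℂ) : Prop :=
  p ∈ V ∧ ∀ v ∈ V, hinner (w - p) v = 0

/-- The rank of the shifted Hankel operator K_u. -/
def kuRank (u : ℕ → ℂ) : Cardinal :=
  Module.rank ℂ (Submodule.span ℂ (khankel u '' {h | MemL2 h}))

/-- The rank of the Hankel operator H_u. -/
def huRank (u : ℕ → ℂ) : Cardinal :=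
  Module.rank ℂ (Submodule.span ℂ (hankel u '' {h | MemL2 h}))

/-- ℒ(N) : rank K_u = N. -/
def InLN (N : ℕ) (u : ℕ → ℂ) : Prop := MemL2 u ∧ kuRank u = N

/-- The constant function 1 as an element of ℓ². -/
def oneH : Hardy := lp.single 2 0 1


/-- The squared operator norm of the Hankel operator H_u on ℓ². -/
def huOpNormSq (u : ℕ → ℂ) : ℝ :=
  sSup {r : ℝ | ∃ h : ℕ → ℂ, MemL2 h ∧ l2normSq h = 1 ∧ r = l2normSq (hankel u h)}

lemma memℓp_two_iff_summable_norm_sq {ι : Type*} {f : ι → ℂ} :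
    Memℓp f 2 ↔ Summable fun n => ‖f n‖ ^ 2 := by
  rw [memℓp_gen_iff (by norm_num)]
  norm_num

lemma summable_mul_conj {ι : Type*} {f g : ι → ℂ} (hf : Summable fun n => ‖f n‖ ^ 2)
    (hg : Summable fun n => ‖g n‖ ^ 2) : Summable fun n => f n * conj (g n) := by
  refine Summable.of_norm_bounded (hf.add hg) fun n => ?_
  rw [norm_mul, RCLike.norm_conj]
  nlinarith [sq_nonneg (‖f n‖ - ‖g n‖), norm_nonneg (f n), norm_nonneg (g n)]

lemma norm_tsum_mul_conj_sq_le {f g : ℕ → ℂ} (hf : MemL2 f) (hg : MemL2 g) :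
    ‖∑' n, f n * conj (g n)‖ ^ 2 ≤ l2normSq f * l2normSq g := by
  have norm_sq (h : Hardy) : ‖h‖ ^ 2 = l2normSq h := by
    have := lp.norm_rpow_eq_tsum (p := 2) (by norm_num) h
    norm_num at this
    exact this
  have h := norm_inner_le_norm (𝕜 := ℂ) (⟨g, hg⟩ : Hardy) ⟨f, hf⟩
  have hin : inner ℂ (⟨g, hg⟩ : Hardy) ⟨f, hf⟩ = ∑' n, f n * conj (g n) := by
    rw [lp.inner_eq_tsum]
    rfl
  rw [hin] at h
  calc _ ≤ (‖(⟨g, hg⟩ : Hardy)‖ * ‖(⟨f, hf⟩ : Hardy)‖) ^ 2 := by gcongr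
    _ = l2normSq f * l2normSq g := by rw [mul_pow, norm_sq, norm_sq, mul_comm]

lemma MemHs.summable_hankel_symbol {u : ℕ → ℂ} (hu : MemHs (1/2) u) :
    Summable fun q : ℕ × ℕ => ‖u (q.1 + q.2)‖ ^ 2 := by
  rw [← (Finset.HasAntidiagonal.sigmaAntidiagonalEquivProd (A := ℕ)).summable_iff,
    summable_sigma_of_nonneg (fun _ => by simp only [Function.comp_apply]; positivity)]
  refine ⟨fun n => Summable.of_finite, ?_⟩
  refine Summable.of_nonneg_of_le (fun n => tsum_nonneg fun _ => sq_nonneg _) (fun n => ?_)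
    (hu.mul_left 2)
  have h1 : ∀ c : Finset.HasAntidiagonal.antidiagonal n,
      ((fun q : ℕ × ℕ => ‖u (q.1 + q.2)‖ ^ 2) ∘
        Finset.HasAntidiagonal.sigmaAntidiagonalEquivProd) ⟨n, c⟩ = ‖u n‖ ^ 2 := by
    rintro ⟨c, hc⟩
    simp [Finset.HasAntidiagonal.sigmaAntidiagonalEquivProd,
      Finset.HasAntidiagonal.mem_antidiagonal.mp hc]
  have hn : (0 : ℝ) ≤ n := n.cast_nonneg
  have h2 : ((n : ℝ) + 1) ≤ 2 * (1 + (n : ℝ) ^ 2) ^ (1 / 2 : ℝ) := by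
    rw [← Real.sqrt_eq_rpow]
    nlinarith [Real.sq_sqrt (show 0 ≤ 1 + (n : ℝ) ^ 2 by positivity),
      Real.sqrt_nonneg (1 + (n : ℝ) ^ 2), sq_nonneg ((n : ℝ) - 1),
      Real.le_sqrt_of_sq_le (show (n : ℝ) ^ 2 ≤ 1 + (n : ℝ) ^ 2 by linarith),
      Real.le_sqrt_of_sq_le (show (1 : ℝ) ^ 2 ≤ 1 + (n : ℝ) ^ 2 by nlinarith)]
  rw [tsum_congr h1, tsum_fintype, Finset.sum_const, Finset.card_univ, Fintype.card_coe,
    Finset.Nat.card_antidiagonal, nsmul_eq_mul, ← mul_assoc]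
  push_cast
  gcongr

lemma norm_hankel_sq_le {u h : ℕ → ℂ} (hu : MemHs (1/2) u) (hh : MemL2 h) (k : ℕ) :
    ‖hankel u h k‖ ^ 2 ≤ (∑' l, ‖u (k + l)‖ ^ 2) * l2normSq h :=
  norm_tsum_mul_conj_sq_le (f := fun l => u (k + l))
    (memℓp_two_iff_summable_norm_sq.2 (hu.summable_hankel_symbol.prod_factor k)) hh

lemma MemL2.hankel {u h : ℕ → ℂ} (hu : MemHs (1/2) u) (hh : MemL2 h) : MemL2 (hankel u h) :=
  memℓp_two_iff_summable_norm_sq.2 <| Summable.of_nonneg_of_le (fun _ => sq_nonneg _)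
    (norm_hankel_sq_le hu hh) (hu.summable_hankel_symbol.prod.mul_right _)

lemma l2normSq_hankel_le {u h : ℕ → ℂ} (hu : MemHs (1/2) u) (hh : MemL2 h) :
    l2normSq (hankel u h) ≤ (∑' k, ∑' l, ‖u (k + l)‖ ^ 2) * l2normSq h := by
  rw [← tsum_mul_right]
  exact Summable.tsum_le_tsum (norm_hankel_sq_le hu hh)
    (memℓp_two_iff_summable_norm_sq.1 (hh.hankel hu))
    (hu.summable_hankel_symbol.prod.mul_right _)

lemma l2normSq_const_mul (c : ℂ) (f : ℕ → ℂ) :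
    l2normSq (fun n => c * f n) = ‖c‖ ^ 2 * l2normSq f := by
  simp only [l2normSq, norm_mul, mul_pow, tsum_mul_left]

lemma hankel_const_mul (u : ℕ → ℂ) (c : ℂ) (h : ℕ → ℂ) :
    hankel u (fun n => c * h n) = fun k => conj c * hankel u h k := by
  funext k
  simp only [hankel, map_mul, ← tsum_mul_left]
  exact tsum_congr fun l => by ring

lemma MemL2.const_mul {f : ℕ → ℂ} (hf : MemL2 f) (c : ℂ) : MemL2 fun n => c * f n :=
  Memℓp.const_mul hf c

lemma l2normSq_hankel_le_opNorm {u h : ℕ → ℂ} (hu : MemHs (1/2) u) (hh : MemL2 h)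
    (hpos : 0 < l2normSq h) : l2normSq (hankel u h) ≤ huOpNormSq u * l2normSq h := by
  set c : ℂ := (((Real.sqrt (l2normSq h))⁻¹ : ℝ) : ℂ)
  have hc : ‖c‖ ^ 2 = (l2normSq h)⁻¹ := by
    rw [Complex.norm_real, Real.norm_eq_abs, sq_abs, inv_pow, Real.sq_sqrt hpos.le]
  have hle : l2normSq (hankel u fun n => c * h n) ≤ huOpNormSq u := by
    refine le_csSup ⟨∑' k, ∑' l, ‖u (k + l)‖ ^ 2, ?_⟩ ⟨_, hh.const_mul c, ?_, rfl⟩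
    · rintro r ⟨g, hg, hg1, rfl⟩
      simpa [hg1] using l2normSq_hankel_le hu hg
    · rw [l2normSq_const_mul, hc, inv_mul_cancel₀ hpos.ne']
  rwa [hankel_const_mul, l2normSq_const_mul, RCLike.norm_conj, hc, inv_mul_le_iff₀ hpos,
    mul_comm] at hle

lemma hinner_self (f : ℕ → ℂ) : hinner f f = (l2normSq f : ℂ) := by
  simp only [hinner, l2normSq, Complex.mul_conj', Complex.ofReal_tsum, Complex.ofReal_pow]

lemma conj_hinner (f g : ℕ → ℂ) : conj (hinner f g) = hinner g f := by
  simp only [hinner, Complex.conj_tsum, map_mul, Complex.conj_conj, mul_comm]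

lemma hinner_sub_mul_left {f g h : ℕ → ℂ} (c : ℂ) (hf : MemL2 f) (hg : MemL2 g) (hh : MemL2 h) :
    hinner (fun n => f n - c * g n) h = hinner f h - c * hinner g h := by
  have hfh := summable_mul_conj (memℓp_two_iff_summable_norm_sq.1 hf) (memℓp_two_iff_summable_norm_sq.1 hh)
  have hgh := summable_mul_conj (memℓp_two_iff_summable_norm_sq.1 hg) (memℓp_two_iff_summable_norm_sq.1 hh)
  simp only [hinner, ← tsum_mul_left]
  rw [← hfh.tsum_sub (hgh.mul_left c)]
  exact tsum_congr fun n => by ring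

lemma hinner_hankel_comm {u a b : ℕ → ℂ} (hu : MemHs (1/2) u) (ha : MemL2 a) (hb : MemL2 b) :
    hinner (hankel u a) b = hinner (hankel u b) a := by
  have hab : Summable fun q : ℕ × ℕ => ‖a q.2 * b q.1‖ ^ 2 := by
    refine ((memℓp_two_iff_summable_norm_sq.1 hb).mul_of_nonneg (memℓp_two_iff_summable_norm_sq.1 ha)
      (fun _ => sq_nonneg _) (fun _ => sq_nonneg _)).congr fun q => ?_
    rw [norm_mul, mul_pow, mul_comm]
  have hs := summable_mul_conj hu.summable_hankel_symbol hab
  simp only [hinner, hankel, ← tsum_mul_right]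
  calc _ = ∑' k, ∑' l, u (k + l) * conj (a l * b k) :=
        tsum_congr fun k => tsum_congr fun l => by rw [map_mul]; ring
    _ = ∑' l, ∑' k, u (k + l) * conj (a l * b k) := (Summable.tsum_comm hs).symm
    _ = _ := tsum_congr fun l => tsum_congr fun k => by rw [map_mul, add_comm k l]; ring

lemma hinner_hu2_self {u h : ℕ → ℂ} (hu : MemHs (1/2) u) (hh : MemL2 h) :
    hinner (hu2 u h) h = (l2normSq (hankel u h) : ℂ) := by
  rw [hu2, hinner_hankel_comm hu (hh.hankel hu) hh, hinner_self]

lemma hinner_hu2_comm {u f g : ℕ → ℂ} (hu : MemHs (1/2) u) (hf : MemL2 f) (hg : MemL2 g) :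
    hinner (hu2 u f) g = hinner f (hu2 u g) := by
  rw [hu2, hinner_hankel_comm hu (hf.hankel hu) hg, ← conj_hinner _ f, hu2,
    hinner_hankel_comm hu (hg.hankel hu) hf, conj_hinner]

lemma ku2_eq {u h : ℕ → ℂ} (hu : MemHs (1/2) u) (hh : MemL2 h) (k : ℕ) :
    ku2 u h k = hu2 u h k - hinner h u * u k := by
  have hs := summable_mul_conj (hu.summable_hankel_symbol.prod_factor k)
    (memℓp_two_iff_summable_norm_sq.1 (hh.hankel hu))
  have h0 : conj (hankel u h 0) = hinner h u := by
    rw [← conj_hinner u h]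
    simp only [hankel, hinner, zero_add]
  rw [hu2, hankel, hs.tsum_eq_zero_add, h0, add_zero, mul_comm (u k), add_sub_cancel_left]
  simp only [ku2, khankel, hankel, add_assoc, add_comm 1]

lemma hankel_sub_mul {u f g : ℕ → ℂ} (hu : MemHs (1/2) u) (hf : MemL2 f) (hg : MemL2 g)
    (x : ℝ) (k : ℕ) :
    hankel u (fun n => f n - x * g n) k = hankel u f k - x * hankel u g k := by
  have hk := hu.summable_hankel_symbol.prod_factor k
  have hf := summable_mul_conj hk (memℓp_two_iff_summable_norm_sq.1 hf)
  have hg := summable_mul_conj hk (memℓp_two_iff_summable_norm_sq.1 hg)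
  simp only [hankel, ← tsum_mul_left]
  rw [← hf.tsum_sub (hg.mul_left (x : ℂ))]
  exact tsum_congr fun n => by rw [map_sub, map_mul, Complex.conj_ofReal]; ring

lemma hankel_oneSeq (u : ℕ → ℂ) : hankel u oneSeq = u := by
  funext k
  rw [hankel, tsum_eq_single 0 (by intro l hl; simp [oneSeq, hl])]
  simp [oneSeq]

lemma hinner_oneSeq (f : ℕ → ℂ) : hinner f oneSeq = f 0 := by
  rw [hinner, tsum_eq_single 0 (by intro l hl; simp [oneSeq, hl])]
  simp [oneSeq]

lemma coe_oneH : ⇑oneH = oneSeq := by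
  funext n
  by_cases h : n = 0
  · subst h; simp [oneH, oneSeq]
  · simp [oneH, oneSeq, h]

/-- A surjective right inverse of `I - x A` is also a left inverse. -/
lemma resolvent_eq_of_sub_mul_eq {A : (ℕ → ℂ) → ℕ → ℂ} {x : ℂ} {R : Hardy →L[ℂ] Hardy}
    (hR : ∀ h : Hardy, ∀ k, (R h) k - x * A (R h) k = h k)
    (hsurj : Function.Surjective R) {g f : Hardy} (hg : ∀ k, g k - x * A g k = f k) :
    R f = g := by
  obtain ⟨f', rfl⟩ := hsurj g
  congr 1
  ext k
  rw [← hg k, hR]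

/-- With `J_x(u) = ((I−xH_u²)⁻¹1|1) > 0`:
(i) `(I−xK_u²)⁻¹u = (1/J_x(u)) (I−xH_u²)⁻¹u`; and (ii) for every `f ∈ L²₊`,
`(I−xH_u²)⁻¹f − (I−xK_u²)⁻¹f = (x/J_x(u)) (f | (I−xH_u²)⁻¹u) (I−xH_u²)⁻¹u`. -/
theorem resolvent_difference_identity (u : ℕ → ℂ) (hu : MemHs (1/2) u)
    (humem : Memℓp u 2) (x : ℝ) (hx : x * huOpNormSq u < 1)
    (RH RK : Hardy →L[ℂ] Hardy)
    (hRH : ∀ h : Hardy, ∀ k, (RH h) k - (x : ℂ) * hu2 u (⇑(RH h)) k = h k)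
    (hRHbij : Function.Bijective (⇑RH))
    (hRK : ∀ h : Hardy, ∀ k, (RK h) k - (x : ℂ) * ku2 u (⇑(RK h)) k = h k)
    (hRKbij : Function.Bijective (⇑RK)) :
    ∀ J : ℂ, J = hinner (⇑(RH oneH)) oneSeq →
      (∀ k, (RK ⟨u, humem⟩) k = 1 / J * (RH ⟨u, humem⟩) k) ∧
      (∀ f : Hardy, ∀ k, (RH f) k - (RK f) k =
        (x : ℂ) / J * hinner (⇑f) (⇑(RH ⟨u, humem⟩)) * (RH ⟨u, humem⟩) k) := by
  intro J hJ
  set U : Hardy := ⟨u, humem⟩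
  set w := RH oneH
  set v := RH U
  have hw : MemL2 w := lp.memℓp w
  have hv : MemL2 v := lp.memℓp v
  have hHw := hw.hankel hu
  have hu2_mem {h : ℕ → ℂ} (hh : MemL2 h) : MemL2 (hu2 u h) := (hh.hankel hu).hankel hu
  have hHHw : MemL2 (hu2 u w) := hu2_mem hw
  have hHHv : MemL2 (hu2 u v) := hu2_mem hv
  have hw_eq : (fun k => w k - (x : ℂ) * hu2 u w k) = oneSeq := by
    rw [← coe_oneH]
    exact funext (hRH oneH)
  have hv_eq : (fun k => v k - (x : ℂ) * hu2 u v k) = u := funext (hRH U)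
  have hv_hankel : v = ⟨hankel u w, hHw⟩ := by
    refine resolvent_eq_of_sub_mul_eq hRH hRHbij.2 fun k => ?_
    change hankel u w k - (x : ℂ) * hankel u (hu2 u w) k = u k
    rw [← hankel_sub_mul hu hw hHHw, hw_eq, hankel_oneSeq]
  have hv_coe : ⇑v = hankel u w := congrArg (fun g : Hardy => ⇑g) hv_hankel
  have hvu_real : hinner v u = hinner u v := by
    have huv : hinner u v = ((l2normSq v - x * l2normSq (hankel u v) : ℝ) : ℂ) := by
      conv_lhs => rw [← hv_eq]
      rw [hinner_sub_mul_left _ hv hHHv hv, hinner_self, hinner_hu2_self hu hv]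
      push_cast
      rfl
    rw [← conj_hinner u v, huv, Complex.conj_ofReal]
  have hJ_eq : J = 1 + x * hinner v u := by
    have h0 := congrFun hw_eq 0
    have h1 : hu2 u w 0 = hinner u v := by
      rw [hu2, ← hv_coe, hankel, hinner]
      simp only [zero_add]
    simp only [h1, oneSeq, if_true] at h0
    rw [hJ, hinner_oneSeq, hvu_real, ← h0]
    ring
  have hJ_ne : J ≠ 0 := by
    have hw_ne : w ≠ 0 := by
      intro h
      have : oneH = 0 := hRHbij.1 (h.trans (map_zero RH).symm)
      have := congrArg (fun g : Hardy => g 0) this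
      simp [coe_oneH, oneSeq] at this
    have hw_pos : 0 < l2normSq w := by
      obtain ⟨n, hn⟩ : ∃ n, w n ≠ 0 := by
        by_contra! h
        exact hw_ne (lp.ext (funext h))
      exact (memℓp_two_iff_summable_norm_sq.1 hw).tsum_pos (fun _ => sq_nonneg _) n (by positivity)
    have hJ_real : J = ((l2normSq w - x * l2normSq (hankel u w) : ℝ) : ℂ) := by
      rw [hJ, ← conj_hinner]
      conv_lhs => rw [← hw_eq]
      rw [hinner_sub_mul_left _ hw hHHw hw, hinner_self, hinner_hu2_self hu hw]
      push_cast
      simp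
    rw [hJ_real, Complex.ofReal_ne_zero]
    refine ne_of_gt ?_
    have hH_nonneg : 0 ≤ l2normSq (hankel u w) := tsum_nonneg fun _ => sq_nonneg _
    have hle := l2normSq_hankel_le_opNorm hu hw hw_pos
    rcases le_total x 0 with hx0 | hx0 <;> nlinarith
  have hRK_RH (f : Hardy) : RH f = RK (f + ((x : ℂ) * hinner (RH f) u) • U) := by
    refine (resolvent_eq_of_sub_mul_eq hRK hRKbij.2 fun k => ?_).symm
    rw [ku2_eq hu (lp.memℓp (RH f)), lp.coeFn_add, lp.coeFn_smul, Pi.add_apply, Pi.smul_apply,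
      ← hRH f k, smul_eq_mul]
    change _ = _ + _ * u k
    ring
  have hRKU : J • RK U = v := by
    rw [hJ_eq, ← map_smul, add_smul, one_smul]
    exact (hRK_RH U).symm
  have hRKU' : RK U = (1 / J) • v := by
    rw [← hRKU, smul_smul, one_div, inv_mul_cancel₀ hJ_ne, one_smul]
  refine ⟨fun k => by rw [hRKU']; rfl, fun f k => ?_⟩
  have hg : MemL2 (RH f) := lp.memℓp (RH f)
  have hgu : hinner (RH f) u = hinner f v := by
    have hf_eq : (fun k => RH f k - (x : ℂ) * hu2 u (RH f) k) = f := funext (hRH f)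
    rw [← hf_eq, hinner_sub_mul_left _ hg (hu2_mem hg) hv,
      hinner_hu2_comm hu hg hv, ← conj_hinner u]
    conv_lhs => rw [← hv_eq]
    rw [hinner_sub_mul_left _ hv hHHv hg, map_sub, map_mul, Complex.conj_ofReal, conj_hinner,
      conj_hinner]
  have h := congrArg (fun g : Hardy => g k) (hRK_RH f)
  simp only [map_add, map_smul, hRKU', hgu, smul_smul, lp.coeFn_add, lp.coeFn_smul, Pi.add_apply,
    Pi.smul_apply, smul_eq_mul] at h
  rw [h]
  ring

end
end

section
/- Let 𝓗 be a complex Hilbert space, I ⊆ ℝ an open interval containing 0, and P : I → B(𝓗) a continuously differentiable family of orthogonal projections (P(t)² = P(t) = P(t)*). Let Q(t) := [P'(t), P(t)]. Then the linear ODE U'(t) = Q(t)U(t), U(0) = Id, has a unique solution U : I → B(𝓗); each U(t) is unitary; and P(t) = U(t) P(0) U(t)* for every t ∈ I. -/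
noncomputable section

section LinearODE

open Set MeasureTheory
open scoped Nat

lemma exists_Ioo_mem_and_Icc_subset {I : Set ℝ} (hIo : IsOpen I) (hIc : I.OrdConnected)
    {x y : ℝ} (hx : x ∈ I) (hy : y ∈ I) :
    ∃ a b, x ∈ Ioo a b ∧ y ∈ Ioo a b ∧ Icc a b ⊆ I := by
  have left_mem (z : ℝ) (hz : z ∈ I) : ∃ a < z, a ∈ I := by
    obtain ⟨a, haz, ha⟩ := exists_Ioc_subset_of_mem_nhds (hIo.mem_nhds hz) (exists_lt z)
    exact ⟨(a + z) / 2, by linarith, ha ⟨by linarith, by linarith⟩⟩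
  have right_mem (z : ℝ) (hz : z ∈ I) : ∃ b > z, b ∈ I := by
    obtain ⟨b, hzb, hb⟩ := exists_Ico_subset_of_mem_nhds (hIo.mem_nhds hz) (exists_gt z)
    exact ⟨(z + b) / 2, by linarith, hb ⟨by linarith, by linarith⟩⟩
  obtain ⟨a, hlt, ha⟩ := left_mem (min x y) (by grind)
  obtain ⟨b, hgt, hb⟩ := right_mem (max x y) (by grind)
  rw [lt_min_iff] at hlt
  rw [gt_iff_lt, max_lt_iff] at hgt
  exact ⟨a, b, ⟨hlt.1, hgt.1⟩, ⟨hlt.2, hgt.2⟩, hIc.out ha hb⟩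

/-- Uniqueness for homogeneous linear differential inequalities on an open interval. -/
lemma eq_zero_of_hasDerivAt_of_norm_le_mul_norm {E : Type*} [NormedAddCommGroup E]
    [NormedSpace ℝ E] {I : Set ℝ} (hIc : I.OrdConnected) (h0 : (0 : ℝ) ∈ I)
    {k : ℝ → ℝ} (hk : ContinuousOn k I) {Y Y' : ℝ → E} (hY : ∀ t ∈ I, HasDerivAt Y (Y' t) t)
    (hYk : ∀ t ∈ I, ‖Y' t‖ ≤ k t * ‖Y t‖) (hY0 : Y 0 = 0) {t : ℝ} (ht : t ∈ I) :
    Y t = 0 := by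
  have hsub : uIcc 0 t ⊆ I := hIc.uIcc_subset h0 ht
  obtain ⟨K, hK⟩ := isCompact_uIcc.exists_bound_of_continuousOn (hk.mono hsub)
  have bound (s : ℝ) (hs : s ∈ uIcc 0 t) : ‖Y' s‖ ≤ K * ‖Y s‖ :=
    (hYk s (hsub hs)).trans <| by gcongr; exact (le_abs_self _).trans (hK s hs)
  rcases le_total 0 t with h | h
  · rw [uIcc_of_le h] at hsub bound
    exact eq_zero_of_abs_deriv_le_mul_abs_self_of_eq_zero_right
      (fun s hs ↦ (hY s (hsub hs)).continuousAt.continuousWithinAt)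
      (fun s hs ↦ (hY s (hsub (Ico_subset_Icc_self hs))).hasDerivWithinAt) hY0
      (fun s hs ↦ bound s (Ico_subset_Icc_self hs)) t ⟨h, le_rfl⟩
  · rw [uIcc_of_ge h] at hsub bound
    have hmem {s : ℝ} (hs : s ∈ Icc 0 (-t)) : -s ∈ Icc t 0 :=
      ⟨by linarith [hs.2], by linarith [hs.1]⟩
    have hderiv (s : ℝ) (hs : s ∈ Icc 0 (-t)) :
        HasDerivAt (fun s ↦ Y (-s)) (-Y' (-s)) s := by
      simpa [Function.comp_def] using (hY (-s) (hsub (hmem hs))).scomp s (hasDerivAt_neg s)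
    simpa using eq_zero_of_abs_deriv_le_mul_abs_self_of_eq_zero_right
      (fun s hs ↦ (hderiv s hs).continuousAt.continuousWithinAt)
      (fun s hs ↦ (hderiv s (Ico_subset_Icc_self hs)).hasDerivWithinAt) (by simpa using hY0)
      (fun s hs ↦ by simpa using bound (-s) (hmem (Ico_subset_Icc_self hs))) (-t)
      ⟨by linarith, le_rfl⟩

variable {A : Type*} [NormedRing A] [NormedAlgebra ℝ A]

/-- The terms of the Dyson series of `Q`, based at time `0`. -/
def dysonTerm (Q : ℝ → A) : ℕ → ℝ → A
  | 0 => fun _ ↦ 1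
  | n + 1 => fun t ↦ ∫ s in (0 : ℝ)..t, Q s * dysonTerm Q n s

lemma dysonTerm_succ_zero (Q : ℝ → A) (n : ℕ) : dysonTerm Q (n + 1) 0 = 0 := by
  simp [dysonTerm]

lemma norm_dysonTerm_le {Q : ℝ → A} {a b M : ℝ} (hM0 : 0 ≤ M) (h0 : (0 : ℝ) ∈ Icc a b)
    (hM : ∀ t ∈ Icc a b, ‖Q t‖ ≤ M) (n : ℕ) {t : ℝ} (ht : t ∈ Icc a b) :
    ‖dysonTerm Q n t‖ ≤ (M * |t|) ^ n / n ! * ‖(1 : A)‖ := by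
  induction n generalizing t with
  | zero => simp [dysonTerm]
  | succ n ih =>
    calc ‖dysonTerm Q (n + 1) t‖
      _ ≤ ∫ s in uIoc 0 t, M ^ (n + 1) / n ! * ‖(1 : A)‖ * |s - 0| ^ n := by
        rw [dysonTerm, intervalIntegral.norm_intervalIntegral_eq]
        refine norm_integral_le_of_norm_le (Continuous.integrableOn_uIoc (by fun_prop)) ?_
        refine ae_restrict_of_forall_mem measurableSet_uIoc fun s hs ↦ ?_
        have hs' : s ∈ Icc a b := uIcc_subset_Icc h0 ht (uIoc_subset_uIcc hs)
        calc ‖Q s * dysonTerm Q n s‖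
          _ ≤ ‖Q s‖ * ‖dysonTerm Q n s‖ := norm_mul_le _ _
          _ ≤ M * ((M * |s|) ^ n / n ! * ‖(1 : A)‖) := by
            gcongr
            exacts [hM s hs', ih hs']
          _ = M ^ (n + 1) / n ! * ‖(1 : A)‖ * |s - 0| ^ n := by
            rw [sub_zero]
            ring
      _ = (M * |t|) ^ (n + 1) / (n + 1)! * ‖(1 : A)‖ := by
        rw [integral_const_mul, integral_pow_abs_sub_uIoc, sub_zero, Nat.factorial_succ]
        push_cast
        field_simp
        ring

variable [CompleteSpace A]

lemma hasDerivAt_integral_mul {I : Set ℝ} (hIo : IsOpen I) (hIc : I.OrdConnected)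
    (h0 : (0 : ℝ) ∈ I) {Q F : ℝ → A} (hQ : ContinuousOn Q I) (hF : ContinuousOn F I) {t : ℝ}
    (ht : t ∈ I) : HasDerivAt (fun t ↦ ∫ s in (0 : ℝ)..t, Q s * F s) (Q t * F t) t := by
  have hQF : ContinuousOn (fun s ↦ Q s * F s) I := hQ.mul hF
  exact intervalIntegral.integral_hasDerivAt_right
    (hQF.mono (hIc.uIcc_subset h0 ht)).intervalIntegrable
    (hQF.stronglyMeasurableAtFilter hIo t ht) (hQF.continuousAt (hIo.mem_nhds ht))

lemma hasDerivAt_dysonTerm_succ {I : Set ℝ} (hIo : IsOpen I) (hIc : I.OrdConnected)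
    (h0 : (0 : ℝ) ∈ I) {Q : ℝ → A} (hQ : ContinuousOn Q I) (n : ℕ) {t : ℝ} (ht : t ∈ I) :
    HasDerivAt (dysonTerm Q (n + 1)) (Q t * dysonTerm Q n t) t := by
  induction n generalizing t with
  | zero => exact hasDerivAt_integral_mul hIo hIc h0 hQ (continuousOn_const (c := 1)) ht
  | succ n ih =>
    exact hasDerivAt_integral_mul hIo hIc h0 hQ
      (fun s hs ↦ (ih hs).continuousAt.continuousWithinAt) ht

/-- A linear differential equation in a Banach algebra has a solution on every open interval on
which its coefficient is continuous. -/
theorem exists_forall_hasDerivAt_mul {I : Set ℝ} (hIo : IsOpen I) (hIc : I.OrdConnected)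
    (h0 : (0 : ℝ) ∈ I) {Q : ℝ → A} (hQ : ContinuousOn Q I) :
    ∃ U : ℝ → A, U 0 = 1 ∧ ∀ t ∈ I, HasDerivAt U (Q t * U t) t := by
  refine ⟨fun t ↦ 1 + ∑' n, dysonTerm Q (n + 1) t, by simp [dysonTerm_succ_zero], fun t ht ↦ ?_⟩
  obtain ⟨a, b, h0ab, htab, hsub⟩ := exists_Ioo_mem_and_Icc_subset hIo hIc h0 ht
  obtain ⟨M, hM⟩ := isCompact_Icc.exists_bound_of_continuousOn (hQ.mono hsub)
  have hM0 : 0 ≤ M := (norm_nonneg _).trans (hM t (Ioo_subset_Icc_self htab))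
  have hterm (n : ℕ) (s : ℝ) (hs : s ∈ Ioo a b) :
      ‖dysonTerm Q n s‖ ≤ (M * (b - a)) ^ n / n ! * ‖(1 : A)‖ := by
    refine (norm_dysonTerm_le hM0 (Ioo_subset_Icc_self h0ab) hM n
      (Ioo_subset_Icc_self hs)).trans ?_
    gcongr
    exact abs_le.2 ⟨by linarith [hs.1, h0ab.2], by linarith [hs.2, h0ab.1]⟩
  have hsummable : Summable fun n : ℕ ↦ (M * (b - a)) ^ n / n ! * ‖(1 : A)‖ :=
    (Real.summable_pow_div_factorial _).mul_right _
  have hderiv : HasDerivAt (fun s ↦ ∑' n, dysonTerm Q (n + 1) s)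
      (∑' n, Q t * dysonTerm Q n t) t := by
    refine hasDerivAt_tsum_of_isPreconnected (hsummable.mul_left M) isOpen_Ioo isPreconnected_Ioo
      (g' := fun n s ↦ Q s * dysonTerm Q n s)
      (fun n s hs ↦ hasDerivAt_dysonTerm_succ hIo hIc h0 hQ n (hsub (Ioo_subset_Icc_self hs)))
      (fun n s hs ↦ (norm_mul_le _ _).trans ?_) h0ab (by simp [dysonTerm_succ_zero, summable_zero])
      htab
    gcongr
    exacts [hM s (Ioo_subset_Icc_self hs), hterm n s hs]
  have hsum : Summable fun n ↦ dysonTerm Q n t :=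
    hsummable.of_norm_bounded fun n ↦ hterm n t htab
  rw [hsum.tsum_mul_left, hsum.tsum_eq_zero_add] at hderiv
  exact hderiv.const_add 1

end LinearODE

section ProjectionFamily

open Set

lemma IsIdempotentElem.mul_mul_self_eq_zero_of_add_eq {R : Type*} [Ring R] {p p' : R}
    (hp : IsIdempotentElem p) (h : p' * p + p * p' = p') : p * p' * p = 0 := by
  have h' := congrArg (p * · * p) h
  simp only [mul_add, add_mul] at h'
  have h1 : p * (p' * p) * p = p * p' * p := by simp only [mul_assoc, hp.eq]
  have h2 : p * (p * p') * p = p * p' * p := by rw [← mul_assoc p p, hp.eq]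
  rw [h1, h2] at h'
  simpa using h'

/-- A derivation of a ring is recovered at an idempotent from its double commutator with it. -/
lemma IsIdempotentElem.commutator_commutator_eq {R : Type*} [Ring R] {p p' : R}
    (hp : IsIdempotentElem p) (h : p' * p + p * p' = p') :
    (p' * p - p * p') * p - p * (p' * p - p * p') = p' := by
  have h0 := hp.mul_mul_self_eq_zero_of_add_eq h
  have h1 : p' * p * p = p' * p := by rw [mul_assoc, hp.eq]
  have h2 : p * (p * p') = p * p' := by rw [← mul_assoc, hp.eq]
  rw [sub_mul, mul_sub, h1, h2, ← mul_assoc, h0]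
  simpa using h

variable {A : Type*} [NormedRing A] [NormedAlgebra ℝ A]

lemma HasDerivAt.mul_add_mul_eq_of_isIdempotentElem {I : Set ℝ} (hIo : IsOpen I)
    {P : ℝ → A} (hproj : ∀ t ∈ I, IsIdempotentElem (P t)) {p' : A} {t : ℝ} (ht : t ∈ I)
    (hP : HasDerivAt P p' t) : p' * P t + P t * p' = p' := by
  refine (hP.mul hP).unique (hP.congr_of_eventuallyEq ?_)
  filter_upwards [hIo.mem_nhds ht] with s hs using hproj s hs

lemma HasDerivAt.isSelfAdjoint [StarRing A] [ContinuousStar A] [StarModule ℝ A] {I : Set ℝ}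
    (hIo : IsOpen I) {P : ℝ → A} (hP : ∀ t ∈ I, IsSelfAdjoint (P t)) {p' : A} {t : ℝ}
    (ht : t ∈ I) (hPt : HasDerivAt P p' t) : IsSelfAdjoint p' := by
  refine hPt.star.unique (hPt.congr_of_eventuallyEq ?_)
  filter_upwards [hIo.mem_nhds ht] with s hs using hP s hs

/-- Solutions with equal initial values of a linear differential equation agree. -/
lemma eqOn_of_hasDerivAt_mul {I : Set ℝ} (hIc : I.OrdConnected) (h0 : (0 : ℝ) ∈ I) {Q : ℝ → A}
    (hQ : ContinuousOn Q I) {U V : ℝ → A} (hU : ∀ t ∈ I, HasDerivAt U (Q t * U t) t)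
    (hV : ∀ t ∈ I, HasDerivAt V (Q t * V t) t) (h : U 0 = V 0) : EqOn U V I := fun t ht ↦
  sub_eq_zero.1 <| eq_zero_of_hasDerivAt_of_norm_le_mul_norm hIc h0 hQ.norm (Y := U - V)
    (fun s hs ↦ (hU s hs).sub (hV s hs))
    (fun s _ ↦ by rw [← mul_sub]; exact norm_mul_le _ _) (by simp [h]) ht

/-- The propagator of a skew-adjoint coefficient is unitary. -/
lemma star_mul_self_and_mul_star_self_of_hasDerivAt_mul [StarRing A] [ContinuousStar A]
    [StarModule ℝ A] {I : Set ℝ} (hIc : I.OrdConnected) (h0 : (0 : ℝ) ∈ I) {Q : ℝ → A}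
    (hQ : ContinuousOn Q I) (hQstar : ∀ t ∈ I, star (Q t) = -Q t) {U : ℝ → A} (hU0 : U 0 = 1)
    (hU : ∀ t ∈ I, HasDerivAt U (Q t * U t) t) {t : ℝ} (ht : t ∈ I) :
    star (U t) * U t = 1 ∧ U t * star (U t) = 1 := by
  have hstar (s : ℝ) (hs : s ∈ I) : HasDerivAt (fun s ↦ star (U s)) (-(star (U s) * Q s)) s := by
    simpa [hQstar s hs] using (hU s hs).star
  constructor
  · refine sub_eq_zero.1 <| eq_zero_of_hasDerivAt_of_norm_le_mul_norm hIc h0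
      (continuousOn_const (c := (0 : ℝ))) (Y := fun s ↦ star (U s) * U s - 1)
      (fun s hs ↦ ((hstar s hs).mul (hU s hs)).sub_const 1)
      (fun s _ ↦ by simp [mul_assoc]) (by simp [hU0]) ht
  · refine sub_eq_zero.1 <| eq_zero_of_hasDerivAt_of_norm_le_mul_norm hIc h0
      (hQ.norm.add hQ.norm) (Y := fun s ↦ U s * star (U s) - 1)
      (fun s hs ↦ ((hU s hs).mul (hstar s hs)).sub_const 1)
      (fun s _ ↦ ?_) (by simp [hU0]) ht
    have h : Q s * U s * star (U s) + U s * -(star (U s) * Q s) =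
        Q s * (U s * star (U s) - 1) - (U s * star (U s) - 1) * Q s := by noncomm_ring
    rw [h, Pi.add_apply, add_mul]
    refine (norm_sub_le _ _).trans (add_le_add (norm_mul_le _ _) ?_)
    exact (norm_mul_le _ _).trans_eq (mul_comm _ _)

/-- The propagator of the commutator of the derivative of a family of idempotents with the family
intertwines the idempotents. -/
lemma mul_propagator_eq_propagator_mul {I : Set ℝ} (hIo : IsOpen I) (hIc : I.OrdConnected)
    (h0 : (0 : ℝ) ∈ I) {P P' : ℝ → A} (hP : ∀ t ∈ I, HasDerivAt P (P' t) t)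
    (hP' : ContinuousOn P' I) (hproj : ∀ t ∈ I, IsIdempotentElem (P t)) {U : ℝ → A}
    (hU0 : U 0 = 1) (hU : ∀ t ∈ I, HasDerivAt U ((P' t * P t - P t * P' t) * U t) t) {t : ℝ}
    (ht : t ∈ I) : P t * U t = U t * P 0 := by
  have hPc : ContinuousOn P I := fun s hs ↦ (hP s hs).continuousAt.continuousWithinAt
  refine eqOn_of_hasDerivAt_mul (U := P * U) (V := fun s ↦ U s * P 0) hIc h0
    ((hP'.mul hPc).sub (hPc.mul hP')) (fun s hs ↦ ?_) (fun s hs ↦ ?_) (by simp [hU0]) ht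
  · have h := sub_eq_iff_eq_add.1 <| (hproj s hs).commutator_commutator_eq
      ((hP s hs).mul_add_mul_eq_of_isIdempotentElem hIo hproj hs)
    have hPU : (P' s * P s - P s * P' s) * (P s * U s) =
        P' s * U s + P s * ((P' s * P s - P s * P' s) * U s) := by
      rw [← mul_assoc, h, add_mul, mul_assoc (P s)]
    exact ((hP s hs).mul (hU s hs)).congr_deriv hPU.symm
  · exact ((hU s hs).mul_const (P 0)).congr_deriv (mul_assoc _ _ _)

end ProjectionFamily

/-- **Kato-type lemma.** Let `P : I → B(𝓗)` be a C¹ family of orthogonal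
projections on a complex Hilbert space, on an open interval `I ∋ 0`. With
`Q(t) = [P'(t), P(t)]`, the linear ODE `U' = Q U`, `U(0) = Id` has a unique solution on
`I`; each `U(t)` is unitary, and `P(t) = U(t) P(0) U(t)*` for every `t ∈ I`. -/
theorem kato_unitary_conjugation_of_projections
    {𝓗 : Type*} [NormedAddCommGroup 𝓗] [InnerProductSpace ℂ 𝓗] [CompleteSpace 𝓗]
    (I : Set ℝ) (hIo : IsOpen I) (hIc : I.OrdConnected) (h0 : (0 : ℝ) ∈ I)
    (P P' : ℝ → 𝓗 →L[ℂ] 𝓗)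
    (hP : ∀ t ∈ I, HasDerivAt P (P' t) t)
    (hP' : ContinuousOn P' I)
    (hproj : ∀ t ∈ I, IsIdempotentElem (P t) ∧ IsSelfAdjoint (P t)) :
    ∃ U : ℝ → 𝓗 →L[ℂ] 𝓗,
      (U 0 = 1 ∧
        (∀ t ∈ I, HasDerivAt U ((P' t * P t - P t * P' t) * U t) t) ∧
        (∀ t ∈ I, star (U t) * U t = 1 ∧ U t * star (U t) = 1) ∧
        (∀ t ∈ I, P t = U t * P 0 * star (U t))) ∧
      ∀ V : ℝ → 𝓗 →L[ℂ] 𝓗, V 0 = 1 →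
        (∀ t ∈ I, HasDerivAt V ((P' t * P t - P t * P' t) * V t) t) →
        Set.EqOn V U I := by
  have hPc : ContinuousOn P I := fun s hs ↦ (hP s hs).continuousAt.continuousWithinAt
  have hQ : ContinuousOn (fun t ↦ P' t * P t - P t * P' t) I := (hP'.mul hPc).sub (hPc.mul hP')
  have hQstar (t : ℝ) (ht : t ∈ I) :
      star (P' t * P t - P t * P' t) = -(P' t * P t - P t * P' t) := by
    have hsa := (hP t ht).isSelfAdjoint hIo (fun s hs ↦ (hproj s hs).2) ht
    simp [hsa.star_eq, (hproj t ht).2.star_eq]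
  obtain ⟨U, hU0, hU⟩ := exists_forall_hasDerivAt_mul hIo hIc h0 hQ
  have hunitary (t : ℝ) (ht : t ∈ I) : star (U t) * U t = 1 ∧ U t * star (U t) = 1 :=
    star_mul_self_and_mul_star_self_of_hasDerivAt_mul hIc h0 hQ hQstar hU0 hU ht
  refine ⟨U, ⟨hU0, hU, hunitary, fun t ht ↦ ?_⟩, fun V hV0 hV ↦
    eqOn_of_hasDerivAt_mul hIc h0 hQ hV hU (hV0.trans hU0.symm)⟩
  rw [← mul_propagator_eq_propagator_mul hIo hIc h0 hP hP' (fun s hs ↦ (hproj s hs).1) hU0 hU ht,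
    mul_assoc, (hunitary t ht).2, mul_one]

end
end

section
/- Let p ∈ ℂ with |p| < 1 and χ_p(z) := (z − p)/(1 − conj(p) z). For every g ∈ L²(S¹), writing conj((I − Π)g) = z·h with h ∈ L²₊, one has [Π, M_{χ_p}] g := Π(χ_p g) − χ_p Π(g) restricted appropriately satisfies Π(χ_p g) − χ_p Π(g) projected to L²₊ equals (1 − |p|²) H_{1/(1−conj(p)z)}(h), where H_{1/(1−conj(p)z)}(h) = Π((1/(1−conj(p)z))·conj(h)). In particular the range of the commutator g ↦ Π∘(Π(χ_p g) − χ_p Π(g)) is at most one-dimensional, spanned by the function z ↦ 1/(1 − conj(p) z). -/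
open Complex Filter
open scoped ComplexConjugate Topology ENNReal

noncomputable section

/-- Taylor coefficients of the Möbius factor χ_p(z) = (z − p)/(1 − conj(p) z), |p| < 1. -/
def chiCoeff (p : ℂ) : ℕ → ℂ := fun n =>
  if n = 0 then -p else (1 - p * conj p) * (conj p) ^ (n - 1)

/-- Taylor coefficients of z ↦ 1/(1 − conj(p) z). -/
def cayleyCoeff (p : ℂ) : ℕ → ℂ := fun n => (conj p) ^ n

/-- The Szegő projector on two-sided Fourier coefficient sequences. -/
def piPlus (g : ℤ → ℂ) : ℤ → ℂ := fun n => if 0 ≤ n then g n else 0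

/-- Multiplication of a holomorphic function (coefficients `a : ℕ → ℂ`) with a general
L² function on the circle (coefficients `g : ℤ → ℂ`), in Fourier coefficients. -/
def mulZ (a : ℕ → ℂ) (g : ℤ → ℂ) : ℤ → ℂ := fun n => ∑' k : ℕ, a k * g (n - k)

theorem summable_chiCoeff_norm {p : ℂ} (hp : ‖p‖ < 1) :
    Summable fun k : ℕ => ‖chiCoeff p k‖ := by
  rw [← summable_nat_add_iff 1]
  simpa [chiCoeff] using
    (summable_geometric_of_lt_one (norm_nonneg p) hp).mul_left ‖1 - p * conj p‖

theorem norm_le_of_summable_norm_sq {g : ℤ → ℂ} (hg : Summable fun n : ℤ => ‖g n‖ ^ 2) (n : ℤ) :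
    ‖g n‖ ≤ √(∑' m : ℤ, ‖g m‖ ^ 2) :=
  Real.le_sqrt_of_sq_le (hg.le_tsum n fun _ _ => by positivity)

theorem summable_chiCoeff_mul {p : ℂ} (hp : ‖p‖ < 1) {g : ℤ → ℂ} {C : ℝ}
    (hg : ∀ n, ‖g n‖ ≤ C) (n : ℤ) : Summable fun k : ℕ => chiCoeff p k * g (n - k) := by
  refine Summable.of_norm_bounded ((summable_chiCoeff_norm hp).mul_right C) fun k => ?_
  rw [norm_mul]
  gcongr
  exact hg _

theorem norm_piPlus_le (g : ℤ → ℂ) (n : ℤ) : ‖piPlus g n‖ ≤ ‖g n‖ := by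
  unfold piPlus
  split_ifs <;> simp

theorem mulZ_chiCoeff_sub_piPlus {p : ℂ} (hp : ‖p‖ < 1) {g : ℤ → ℂ}
    (hg : Summable fun n : ℤ => ‖g n‖ ^ 2) (m : ℕ) :
    mulZ (chiCoeff p) g m - mulZ (chiCoeff p) (piPlus g) m =
      (1 - p * conj p) * ∑' k : ℕ, conj p ^ (m + k) * g (-((k : ℤ) + 1)) := by
  have hb := norm_le_of_summable_norm_sq hg
  have hs := summable_chiCoeff_mul hp hb m
  have hs' := summable_chiCoeff_mul hp (fun n => (norm_piPlus_le g n).trans (hb n)) m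
  unfold mulZ
  rw [← hs.tsum_sub hs', ← (hs.sub hs').sum_add_tsum_nat_add (m + 1), Finset.sum_eq_zero,
    zero_add, ← tsum_mul_left]
  · refine tsum_congr fun k => ?_
    have hneg : ¬ (0 : ℤ) ≤ (m : ℤ) - ((k + (m + 1) : ℕ) : ℤ) := by omega
    have harg : (m : ℤ) - ((k + (m + 1) : ℕ) : ℤ) = -((k : ℤ) + 1) := by omega
    have hexp : k + (m + 1) - 1 = m + k := by omega
    have hne : k + (m + 1) ≠ 0 := by omega
    rw [piPlus, if_neg hneg, harg, chiCoeff, if_neg hne, hexp]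
    ring
  · intro k hk
    have hnonneg : (0 : ℤ) ≤ (m : ℤ) - (k : ℤ) := by
      have := Finset.mem_range.mp hk
      omega
    rw [piPlus, if_pos hnonneg, sub_self]

/-- For `|p| < 1` and `g ∈ L²(S¹)`, writing `conj((I−Π)g) = z·h`,
the commutator `[Π, χ_p]` satisfies `Π(χ_p g) − Π(χ_p Π g) = (1−|p|²) H_{1/(1−conj(p)z)}(h)`;
in particular its range is at most one-dimensional, spanned by `z ↦ 1/(1 − conj(p)z)`. -/
theorem szego_moebius_commutator (p : ℂ) (hp : ‖p‖ < 1) :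
    (∀ g : ℤ → ℂ, (Summable fun n : ℤ => ‖g n‖ ^ 2) →
      ∀ n : ℤ, 0 ≤ n →
        mulZ (chiCoeff p) g n - mulZ (chiCoeff p) (piPlus g) n =
          ((1 - ‖p‖ ^ 2 : ℝ) : ℂ) *
            hankel (cayleyCoeff p) (fun k => conj (g (-((k : ℤ) + 1)))) n.toNat) ∧
    (∀ g : ℤ → ℂ, (Summable fun n : ℤ => ‖g n‖ ^ 2) →
      ∃ c : ℂ, ∀ n : ℤ, 0 ≤ n →
        mulZ (chiCoeff p) g n - mulZ (chiCoeff p) (piPlus g) n = c * (conj p) ^ n.toNat) := by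
  have hnorm : ((1 - ‖p‖ ^ 2 : ℝ) : ℂ) = 1 - p * conj p := by
    rw [Complex.mul_conj, Complex.normSq_eq_norm_sq, Complex.ofReal_sub, Complex.ofReal_one]
  refine ⟨fun g hg n hn => ?_, fun g hg =>
    ⟨(1 - p * conj p) * ∑' k : ℕ, conj p ^ k * g (-((k : ℤ) + 1)), fun n hn => ?_⟩⟩
  · lift n to ℕ using hn
    rw [mulZ_chiCoeff_sub_piPlus hp hg, hnorm]
    simp [hankel, cayleyCoeff]
  · lift n to ℕ using hn
    rw [mulZ_chiCoeff_sub_piPlus hp hg, Int.toNat_natCast, mul_assoc, ← tsum_mul_right]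
    congr 1
    exact tsum_congr fun k => by ring

end
end
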